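/- Strong fatness for the Berger space B¹³ = SU(5)/Sp(2)·S¹: let g = su(5) (traceless skew-Hermitian complex 5×5 matrices) with inner product Q(X,Y) = −Re tr(XY), let k = {diag(A, −tr A) : A ∈ u(4)} (u(4) embedded in the upper-left 4×4 block), and let h ⊂ k be the direct sum of sp(2) (embedded in su(4) as the skew-Hermitian matrices commuting with the standard quaternionic structure on ℂ⁴ ≅ ℍ²) and the center of k, span{diag(i,i,i,i,−4i)}. Let m be the Q-orthogonal complement of k in g and p the Q-orthogonal complement of h in k. Then there exists τ ∈ Λ²m⊗Λ²p such that the operator F + τ restricted to m⊗p is positive-definite. -/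

import Mathlib

/- Common setup: an abstract model of the second and fourth exterior powers
`Λ²V` and `Λ⁴V` of a real inner product space `V`, with the induced inner
products, the identification of 4-vectors with self-adjoint operators on
`Λ²V`, and the Bianchi map. -/

noncomputable section

open scoped InnerProductSpace

/-- A linear operator on a real inner product space is positive-semidefinite. -/
def IsPosSemidef {E : Type*} [NormedAddCommGroup E] [InnerProductSpace ℝ E]
    (T : E →ₗ[ℝ] E) : Prop :=
  ∀ v : E, 0 ≤ ⟪T v, v⟫_ℝ

/-- A linear operator on a real inner product space is positive-definite. -/
def IsPosDef {E : Type*} [NormedAddCommGroup E] [InnerProductSpace ℝ E]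
    (T : E →ₗ[ℝ] E) : Prop :=
  ∀ v : E, v ≠ 0 → 0 < ⟪T v, v⟫_ℝ

/-- An abstract model of the exterior powers `Λ²V` (the type `E2`) and `Λ⁴V`
(the type `E4`) of a real inner product space `V`:
* `wedge2 X Y` models `X ∧ Y ∈ Λ²V` and `wedge4 X Y Z W` models
  `X ∧ Y ∧ Z ∧ W ∈ Λ⁴V`; both are alternating, and their images span.
* The inner products are the induced ones, given by Gram determinants.
* `wedge22` models the wedge product `Λ²V × Λ²V → Λ⁴V`.
* `toOp ω` is the self-adjoint operator on `Λ²V` associated to `ω ∈ Λ⁴V`,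
  determined by `⟪toOp ω (X ∧ Y), Z ∧ W⟫ = ω(X,Y,Z,W) = ⟪ω, X ∧ Y ∧ Z ∧ W⟫`
  (using the identification of `Λ⁴V` with 4-forms via the inner product). -/
structure ExtModel (V E2 E4 : Type*)
    [NormedAddCommGroup V] [InnerProductSpace ℝ V]
    [NormedAddCommGroup E2] [InnerProductSpace ℝ E2]
    [NormedAddCommGroup E4] [InnerProductSpace ℝ E4] where
  wedge2 : V →ₗ[ℝ] V →ₗ[ℝ] E2
  wedge4 : V →ₗ[ℝ] V →ₗ[ℝ] V →ₗ[ℝ] V →ₗ[ℝ] E4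
  wedge22 : E2 →ₗ[ℝ] E2 →ₗ[ℝ] E4
  toOp : E4 →ₗ[ℝ] E2 →ₗ[ℝ] E2
  wedge2_self : ∀ X : V, wedge2 X X = 0
  wedge4_self₁₂ : ∀ X Z W : V, wedge4 X X Z W = 0
  wedge4_self₂₃ : ∀ X Y W : V, wedge4 X Y Y W = 0
  wedge4_self₃₄ : ∀ X Y Z : V, wedge4 X Y Z Z = 0
  span_wedge2 : Submodule.span ℝ {σ : E2 | ∃ X Y : V, σ = wedge2 X Y} = ⊤
  span_wedge4 : Submodule.span ℝ {ω : E4 | ∃ X Y Z W : V, ω = wedge4 X Y Z W} = ⊤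
  inner_wedge2 : ∀ X Y Z W : V,
    ⟪wedge2 X Y, wedge2 Z W⟫_ℝ = ⟪X, Z⟫_ℝ * ⟪Y, W⟫_ℝ - ⟪X, W⟫_ℝ * ⟪Y, Z⟫_ℝ
  inner_wedge4 : ∀ x y : Fin 4 → V,
    ⟪wedge4 (x 0) (x 1) (x 2) (x 3), wedge4 (y 0) (y 1) (y 2) (y 3)⟫_ℝ
      = Matrix.det (Matrix.of fun i j : Fin 4 => ⟪x i, y j⟫_ℝ)
  wedge22_spec : ∀ X Y Z W : V, wedge22 (wedge2 X Y) (wedge2 Z W) = wedge4 X Y Z W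
  toOp_spec : ∀ (ω : E4) (X Y Z W : V),
    ⟪toOp ω (wedge2 X Y), wedge2 Z W⟫_ℝ = ⟪ω, wedge4 X Y Z W⟫_ℝ

namespace ExtModel

variable {V E2 E4 : Type*} [NormedAddCommGroup V] [InnerProductSpace ℝ V]
  [NormedAddCommGroup E2] [InnerProductSpace ℝ E2]
  [NormedAddCommGroup E4] [InnerProductSpace ℝ E4]

/-- The Bianchi map: the 4-linear form associated to an operator
`R : Λ²V → Λ²V` by `b(R)(X,Y,Z,W) = (1/3)(⟪R(X∧Y), Z∧W⟫ + ⟪R(Y∧Z), X∧W⟫ +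
⟪R(Z∧X), Y∧W⟫)`. -/
def bianchi (M : ExtModel V E2 E4) (R : E2 →ₗ[ℝ] E2) (X Y Z W : V) : ℝ :=
  (1 / 3) * (⟪R (M.wedge2 X Y), M.wedge2 Z W⟫_ℝ + ⟪R (M.wedge2 Y Z), M.wedge2 X W⟫_ℝ
    + ⟪R (M.wedge2 Z X), M.wedge2 Y W⟫_ℝ)

end ExtModel

theorem OrthonormalBasis.sum_inner_mul_apply {V ι : Type*} [NormedAddCommGroup V]
    [InnerProductSpace ℝ V] [Fintype ι] {U : Submodule ℝ V} (e : OrthonormalBasis ι ℝ U)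
    (l : V →ₗ[ℝ] ℝ) {X : V} (hX : X ∈ U) :
    ∑ i, ⟪(e i : V), X⟫_ℝ * l (e i) = l X := by
  have h : ∑ i, ⟪(e i : V), X⟫_ℝ • (e i : V) = X := by
    simpa using congrArg (Subtype.val : U → V) (e.sum_repr' ⟨X, hX⟩)
  conv_rhs => rw [← h]
  simp

namespace ExtModel

variable {V E2 E4 : Type*} [NormedAddCommGroup V] [InnerProductSpace ℝ V]
  [NormedAddCommGroup E2] [InnerProductSpace ℝ E2]
  [NormedAddCommGroup E4] [InnerProductSpace ℝ E4]

theorem inner_wedge4_of_orthogonal (M : ExtModel V E2 E4) {U P : Submodule ℝ V}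
    (hUP : ∀ x ∈ U, ∀ y ∈ P, ⟪x, y⟫_ℝ = 0) {u u' X Z : V} {p p' Y W : V}
    (hu : u ∈ U) (hu' : u' ∈ U) (hX : X ∈ U) (hZ : Z ∈ U)
    (hp : p ∈ P) (hp' : p' ∈ P) (hY : Y ∈ P) (hW : W ∈ P) :
    ⟪M.wedge4 u u' p p', M.wedge4 X Y Z W⟫_ℝ =
      -((⟪u, X⟫_ℝ * ⟪u', Z⟫_ℝ - ⟪u, Z⟫_ℝ * ⟪u', X⟫_ℝ) *
        (⟪p, Y⟫_ℝ * ⟪p', W⟫_ℝ - ⟪p, W⟫_ℝ * ⟪p', Y⟫_ℝ)) := by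
  have hPU : ∀ y ∈ P, ∀ x ∈ U, ⟪y, x⟫_ℝ = 0 := fun y hy x hx => by
    rw [real_inner_comm]; exact hUP x hx y hy
  have h := M.inner_wedge4 ![u, u', p, p'] ![X, Y, Z, W]
  simp only [Matrix.cons_val] at h
  rw [h]
  simp [Matrix.det_succ_row_zero, Fin.sum_univ_succ, Fin.succAbove,
    hUP u hu Y hY, hUP u hu W hW, hUP u' hu' Y hY, hUP u' hu' W hW,
    hPU p hp X hX, hPU p hp Z hZ, hPU p' hp' X hX, hPU p' hp' Z hZ]
  ring

/-- A 4-linear form that is skew in a pair of variables from `U` and in a pair of variables from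
`P ⟂ U` is represented by an element of `Λ²U ⊗ Λ²P`. -/
theorem exists_mem_span_wedge4 [FiniteDimensional ℝ V] (M : ExtModel V E2 E4)
    {U P : Submodule ℝ V} (hUP : ∀ x ∈ U, ∀ y ∈ P, ⟪x, y⟫_ℝ = 0)
    (w : V →ₗ[ℝ] V →ₗ[ℝ] V →ₗ[ℝ] V →ₗ[ℝ] ℝ)
    (hw : ∀ X Z Y W, w X Z Y W = -w Z X Y W) (hw' : ∀ X Z Y W, w X Z Y W = -w X Z W Y) :
    ∃ τ ∈ Submodule.span ℝ {ω : E4 | ∃ X Y Z W : V, X ∈ U ∧ Y ∈ U ∧ Z ∈ P ∧ W ∈ P ∧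
        ω = M.wedge4 X Y Z W},
      ∀ X ∈ U, ∀ Z ∈ U, ∀ Y ∈ P, ∀ W ∈ P, ⟪τ, M.wedge4 X Y Z W⟫_ℝ = w X Z Y W := by
  let e := stdOrthonormalBasis ℝ U
  let f := stdOrthonormalBasis ℝ P
  have expand : ∀ X ∈ U, ∀ Z ∈ U, ∀ Y ∈ P, ∀ W ∈ P,
      ∑ i, ∑ j, ∑ a, ∑ b, ⟪(e i : V), X⟫_ℝ * (⟪(e j : V), Z⟫_ℝ * (⟪(f a : V), Y⟫_ℝ *
        (⟪(f b : V), W⟫_ℝ * w (e i) (e j) (f a) (f b)))) = w X Z Y W := by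
    intro X hX Z hZ Y hY W hW
    simp only [← Finset.mul_sum]
    simp only [f.sum_inner_mul_apply _ hW]
    have h1 : ∀ i j, ∑ a, ⟪(f a : V), Y⟫_ℝ * w (e i) (e j) (f a) W = w (e i) (e j) Y W :=
      fun i j => f.sum_inner_mul_apply ((w (e i) (e j)).flip W) hY
    have h2 : ∀ i, ∑ j, ⟪(e j : V), Z⟫_ℝ * w (e i) (e j) Y W = w (e i) Z Y W :=
      fun i => e.sum_inner_mul_apply (((w (e i)).flip Y).flip W) hZ
    simp only [h1, h2]
    exact e.sum_inner_mul_apply (((w.flip Z).flip Y).flip W) hX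
  refine ⟨∑ i, ∑ j, ∑ a, ∑ b, (-(1 / 4) * w (e i) (e j) (f a) (f b)) •
    M.wedge4 (e i) (e j) (f a) (f b), ?_, ?_⟩
  · refine Submodule.sum_mem _ fun i _ => Submodule.sum_mem _ fun j _ =>
      Submodule.sum_mem _ fun a _ => Submodule.sum_mem _ fun b _ =>
      Submodule.smul_mem _ _ (Submodule.subset_span
        ⟨_, _, _, _, (e i).2, (e j).2, (f a).2, (f b).2, rfl⟩)
  · intro X hX Z hZ Y hY W hW
    have h1 := expand X hX Z hZ Y hY W hW
    have h2 := expand Z hZ X hX Y hY W hW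
    have h3 := expand X hX Z hZ W hW Y hY
    have h4 := expand Z hZ X hX W hW Y hY
    have key : w X Z Y W = (1 / 4) * (w X Z Y W - w Z X Y W - w X Z W Y + w Z X W Y) := by
      linarith [hw X Z Y W, hw' X Z Y W, hw' Z X Y W]
    rw [key, ← h1, ← h2, ← h3, ← h4]
    simp only [sum_inner, real_inner_smul_left, ← Finset.sum_sub_distrib,
      ← Finset.sum_add_distrib, Finset.mul_sum]
    refine Finset.sum_congr rfl fun i _ => Finset.sum_congr rfl fun j _ =>
      Finset.sum_congr rfl fun a _ => Finset.sum_congr rfl fun b _ => ?_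
    rw [M.inner_wedge4_of_orthogonal hUP (e i).2 (e j).2 hX hZ (f a).2 (f b).2 hY hW]
    ring

/-- Two operators which agree as bilinear forms on decomposable elements of `U ⊗ P` agree on
`U ⊗ P`. -/
theorem inner_eq_of_mem_span_wedge2 (M : ExtModel V E2 E4) {U P : Submodule ℝ V}
    (S T : E2 →ₗ[ℝ] E2)
    (h : ∀ X ∈ U, ∀ Z ∈ U, ∀ Y ∈ P, ∀ W ∈ P,
      ⟪S (M.wedge2 X Y), M.wedge2 Z W⟫_ℝ = ⟪T (M.wedge2 X Y), M.wedge2 Z W⟫_ℝ)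
    {σ ρ : E2}
    (hσ : σ ∈ Submodule.span ℝ {σ : E2 | ∃ X Y : V, X ∈ U ∧ Y ∈ P ∧ σ = M.wedge2 X Y})
    (hρ : ρ ∈ Submodule.span ℝ {σ : E2 | ∃ X Y : V, X ∈ U ∧ Y ∈ P ∧ σ = M.wedge2 X Y}) :
    ⟪S σ, ρ⟫_ℝ = ⟪T σ, ρ⟫_ℝ := by
  induction hσ using Submodule.span_induction with
  | zero => simp
  | add x y _ _ hx hy => simp only [map_add, inner_add_left, hx, hy]
  | smul c x _ hx => simp only [map_smul, real_inner_smul_left, hx]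
  | mem x hx =>
    obtain ⟨X, Y, hX, hY, rfl⟩ := hx
    induction hρ using Submodule.span_induction with
    | zero => simp
    | add x y _ _ hx hy => simp only [inner_add_right, hx, hy]
    | smul c x _ hx => simp only [real_inner_smul_right, hx]
    | mem x hx =>
      obtain ⟨Z, W, hZ, hW, rfl⟩ := hx
      exact h X hX Z hZ Y hY W hW

end ExtModel

open Matrix in
theorem commutator_commutator_of_block {A B : Matrix (Fin 5) (Fin 5) ℂ} {c : ℂ}
    (hA : ∀ i : Fin 5, A i 4 = 0 ∧ A 4 i = 0)
    (hA2 : A * A = c • diagonal ![1, 1, 1, 1, 0])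
    (hB : ∀ i j : Fin 5, i ≠ 4 → j ≠ 4 → B i j = 0) (hB4 : B 4 4 = 0) :
    A * (A * B - B * A) - (A * B - B * A) * A = c • B := by
  have hABA : A * B * A = 0 := by
    ext i j
    simp only [Matrix.mul_apply, Matrix.zero_apply]
    refine Finset.sum_eq_zero fun k _ => ?_
    by_cases hk : k = 4
    · subst hk; simp [(hA j).2]
    · rw [Finset.sum_eq_zero, zero_mul]
      intro l _
      by_cases hl : l = 4
      · subst hl; simp [(hA i).1]
      · simp [hB l k hl hk]
  have : A * (A * B - B * A) - (A * B - B * A) * A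
      = (A * A) * B + B * (A * A) - 2 • (A * B * A) := by noncomm_ring
  rw [this, hABA, hA2]
  ext i j
  fin_cases i <;> fin_cases j <;>
    simp [Matrix.diagonal_mul, Matrix.mul_diagonal, hB, hB4]

theorem Matrix.apply_eq_neg_star_of_conjTranspose_eq_neg {n : Type*} {A : Matrix n n ℂ}
    (hskew : A.conjTranspose = -A) (i j : n) : A j i = -star (A i j) := by
  have h : star (A i j) = -A j i := congrFun (congrFun hskew j) i
  rw [h, neg_neg]

open Matrix in
theorem mul_self_of_anticommute_quaternionic {A : Matrix (Fin 5) (Fin 5) ℂ}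
    (hA : ∀ i : Fin 5, A i 4 = 0 ∧ A 4 i = 0) (hskew : Aᴴ = -A) (htr : A.trace = 0)
    (h01 : A 0 1 = 0) (h23 : A 2 3 = 0) (h11 : A 1 1 = A 0 0) (h33 : A 3 3 = A 2 2)
    (h13 : A 1 3 = -star (A 0 2)) (h12 : A 1 2 = star (A 0 3)) :
    A * A = ((((A * A).trace).re / 4 : ℝ) : ℂ) • diagonal ![1, 1, 1, 1, 0] := by
  have hs := apply_eq_neg_star_of_conjTranspose_eq_neg hskew
  have h10 := hs 0 1
  have h20 := hs 0 2
  have h30 := hs 0 3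
  have h21 := hs 1 2
  have h31 := hs 1 3
  have h32 := hs 2 3
  have h00 : (A 0 0).re = 0 := by
    have := congrArg Complex.re (hs 0 0); simp at this; linarith
  have h22 : A 2 2 = -A 0 0 := by
    simp [Matrix.trace, Fin.sum_univ_succ, (hA 4).1, h11, h33] at htr
    linear_combination htr / 2
  rw [h22] at h33
  rw [h12] at h21
  rw [h13] at h31
  rw [h01] at h10
  rw [h23] at h32
  have hsq : A * A = (A 0 0 * A 0 0 - A 0 2 * star (A 0 2) - A 0 3 * star (A 0 3)) •
      diagonal ![1, 1, 1, 1, 0] := by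
    ext i j
    simp only [Matrix.mul_apply, Fin.sum_univ_five, Matrix.smul_apply]
    fin_cases i <;> fin_cases j <;>
      simp [hA, h01, h23, h11, h33, h13, h12, h10, h20, h30, h21, h31, h32, h22] <;> ring
  generalize hc : A 0 0 * A 0 0 - A 0 2 * star (A 0 2) - A 0 3 * star (A 0 3) = c at hsq
  have hcim : c.im = 0 := by
    rw [← hc]
    simp [h00]
    ring
  have hcre : ((A * A).trace).re = 4 * c.re := by
    rw [hsq]
    simp [Matrix.trace, Fin.sum_univ_five]
    ring
  rw [hcre, hsq]
  congr 1
  apply Complex.ext <;> simp [hcim]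

set_option maxHeartbeats 1000000 in
open Matrix in
theorem apply_eq_of_orthogonal_quaternionic {A : Matrix (Fin 5) (Fin 5) ℂ}
    {J₀ : Matrix (Fin 4) (Fin 4) ℂ}
    (hJ₀ : J₀ = !![0, -1, 0, 0; 1, 0, 0, 0; 0, 0, 0, -1; 0, 0, 1, 0])
    (hA : ∀ i : Fin 5, A i 4 = 0 ∧ A 4 i = 0) (hskew : Aᴴ = -A)
    (horth : ∀ N : Matrix (Fin 5) (Fin 5) ℂ, Nᴴ = -N → N.trace = 0 →
      (∀ i : Fin 5, N i 4 = 0 ∧ N 4 i = 0) →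
      N.submatrix Fin.castSucc Fin.castSucc * J₀
        = J₀ * (N.submatrix Fin.castSucc Fin.castSucc).map (starRingEnd ℂ) →
      (N * A).trace.re = 0) :
    A 0 1 = 0 ∧ A 2 3 = 0 ∧ A 1 1 = A 0 0 ∧ A 3 3 = A 2 2 ∧
      A 1 3 = -star (A 0 2) ∧ A 1 2 = star (A 0 3) := by
  have hs := apply_eq_neg_star_of_conjTranspose_eq_neg hskew
  have hre : ∀ i, (A i i).re = 0 := fun i => by
    have := congrArg Complex.re (hs i i); simp at this; linarith
  have hN := horth !![A 0 0 - A 1 1, A 0 1, A 0 2 + star (A 1 3), A 0 3 - star (A 1 2), 0;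
      -star (A 0 1), A 1 1 - A 0 0, A 1 2 - star (A 0 3), A 1 3 + star (A 0 2), 0;
      -(A 1 3 + star (A 0 2)), A 0 3 - star (A 1 2), A 2 2 - A 3 3, A 2 3, 0;
      A 1 2 - star (A 0 3), -(A 0 2 + star (A 1 3)), -star (A 2 3), A 3 3 - A 2 2, 0;
      0, 0, 0, 0, 0]
    (by
      ext i j
      fin_cases i <;> fin_cases j <;>
        simp [Complex.ext_iff, hre, conjTranspose_apply] <;> ring_nf <;> simp)
    (by simp [Matrix.trace, Fin.sum_univ_succ])
    (by intro i; fin_cases i <;> simp)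
    (by
      subst hJ₀
      ext i j
      fin_cases i <;> fin_cases j <;>
        simp [Matrix.mul_apply, Fin.sum_univ_succ, Complex.ext_iff, hre] <;> ring_nf <;> simp)
  simp only [Matrix.trace, Matrix.diag_apply, Matrix.mul_apply, Fin.sum_univ_five] at hN
  simp [hA, hre,
    hs 0 1, hs 0 2, hs 0 3, hs 1 2, hs 1 3, hs 2 3] at hN
  have hsum : ((A 0 0).im - (A 1 1).im) ^ 2 + ((A 2 2).im - (A 3 3).im) ^ 2 +
      2 * ((A 0 1).re ^ 2 + (A 0 1).im ^ 2 + (A 2 3).re ^ 2 + (A 2 3).im ^ 2 +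
        ((A 0 2).re + (A 1 3).re) ^ 2 + ((A 0 2).im - (A 1 3).im) ^ 2 +
        ((A 0 3).re - (A 1 2).re) ^ 2 + ((A 0 3).im + (A 1 2).im) ^ 2) = 0 := by
    linear_combination -hN
  have of_sq : ∀ x : ℝ, x ^ 2 ≤ 0 → x = 0 := fun x hx =>
    pow_eq_zero_iff two_ne_zero |>.1 (le_antisymm hx (sq_nonneg x))
  refine ⟨Complex.ext (of_sq _ ?_) (of_sq _ ?_), Complex.ext (of_sq _ ?_) (of_sq _ ?_),
    Complex.ext (by rw [hre, hre]) (sub_eq_zero.1 (of_sq _ ?_)),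
    Complex.ext (by rw [hre, hre]) (sub_eq_zero.1 (of_sq _ ?_)),
    Complex.ext (sub_eq_zero.1 (of_sq _ ?_)) (sub_eq_zero.1 (of_sq _ ?_)),
    Complex.ext (sub_eq_zero.1 (of_sq _ ?_)) (sub_eq_zero.1 (of_sq _ ?_))⟩
  all_goals
    try simp only [Complex.neg_re, Complex.neg_im, Complex.star_def, Complex.conj_re,
      Complex.conj_im]
    linarith [sq_nonneg ((A 0 0).im - (A 1 1).im), sq_nonneg ((A 2 2).im - (A 3 3).im),
      sq_nonneg (A 0 1).re, sq_nonneg (A 0 1).im, sq_nonneg (A 2 3).re, sq_nonneg (A 2 3).im,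
      sq_nonneg ((A 0 2).re + (A 1 3).re), sq_nonneg ((A 0 2).im - (A 1 3).im),
      sq_nonneg ((A 0 3).re - (A 1 2).re), sq_nonneg ((A 0 3).im + (A 1 2).im)]

open Matrix in
/-- The block-diagonal part of `A` for the splitting `ℂ⁵ = ℂ⁴ ⊕ ℂ`. -/
def blockDiagPart (A : Matrix (Fin 5) (Fin 5) ℂ) : Matrix (Fin 5) (Fin 5) ℂ :=
  of fun i j => if i = 4 ↔ j = 4 then A i j else 0

open Matrix in
theorem blockDiagPart_eq_zero {A : Matrix (Fin 5) (Fin 5) ℂ} (hskew : Aᴴ = -A)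
    (h : (blockDiagPart A * A).trace.re = 0) : blockDiagPart A = 0 := by
  have hs := apply_eq_neg_star_of_conjTranspose_eq_neg hskew
  have hterm : ∀ i j, (blockDiagPart A i j * A j i).re = -Complex.normSq (blockDiagPart A i j) := by
    intro i j
    rw [hs i j]
    simp only [blockDiagPart, of_apply]
    split_ifs
    · simp [Complex.normSq_apply]
    · simp
  simp only [Matrix.trace, diag_apply, Matrix.mul_apply, Complex.re_sum, hterm,
    Finset.sum_neg_distrib, neg_eq_zero] at h
  ext i j
  have h1 := (Finset.sum_eq_zero_iff_of_nonneg
    (fun i _ => Finset.sum_nonneg fun j _ => Complex.normSq_nonneg _)).1 h i (Finset.mem_univ i)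
  have h2 := (Finset.sum_eq_zero_iff_of_nonneg
    (fun j _ => Complex.normSq_nonneg _)).1 h1 j (Finset.mem_univ j)
  simpa using h2

open Matrix in
/-- Strong fatness for the Berger space
`B¹³ = SU(5)/Sp(2)·S¹`. Here `g` is (isomorphic, via `φ`, to) the Lie
algebra `su(5)` of traceless skew-Hermitian complex `5×5` matrices, with inner
product `Q(X,Y) = −Re tr(XY)` and bracket `[X,Y] = XY − YX`; `K` corresponds
to `u(4) = {diag(A, −tr A) : A ∈ u(4)}` (upper-left `4×4` block), and `H ⊆ K`
to the direct sum of `sp(2)` (the elements of `su(4)` whose upper-left `4×4`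
block commutes with the standard quaternionic structure `v ↦ J₀ v̄` on
`ℂ⁴ ≅ ℍ²`, i.e. `B·J₀ = J₀·B̄`) and the center `ℝ·diag(i,i,i,i,−4i)` of `K`;
`m = Kᗮ` and `p = Hᗮ ⊓ K` are the `Q`-orthogonal complements of `K` in `g`
and of `H` in `K`. Conclusion: there exists `τ ∈ Λ²m⊗Λ²p` such that `F + τ`
restricted to `m⊗p` is positive-definite, where
`⟪F(X∧Y), Z∧W⟫ = ⟪[X,Y],[Z,W]⟫` for `X,Z ∈ m`, `Y,W ∈ p`. -/
theorem strong_fatness_B13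
    {g : Type*} [NormedAddCommGroup g] [InnerProductSpace ℝ g] [FiniteDimensional ℝ g]
    (br : g →ₗ[ℝ] g →ₗ[ℝ] g)
    (φ : g →ₗ[ℝ] Matrix (Fin 5) (Fin 5) ℂ)
    (hφ_inj : Function.Injective φ)
    (hφ_range : ∀ A : Matrix (Fin 5) (Fin 5) ℂ,
      (∃ X : g, φ X = A) ↔ (Aᴴ = -A ∧ Matrix.trace A = 0))
    (hφ_br : ∀ X Y : g, φ (br X Y) = φ X * φ Y - φ Y * φ X)
    (hQ : ∀ X Y : g, ⟪X, Y⟫_ℝ = -(Matrix.trace (φ X * φ Y)).re)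
    (J₀ : Matrix (Fin 4) (Fin 4) ℂ)
    (hJ₀ : J₀ = !![0, -1, 0, 0; 1, 0, 0, 0; 0, 0, 0, -1; 0, 0, 1, 0])
    (Zc : g)
    (hZc : φ Zc = Matrix.diagonal
      ![Complex.I, Complex.I, Complex.I, Complex.I, (-4 : ℂ) * Complex.I])
    (K H : Submodule ℝ g)
    (hK : ∀ X : g, X ∈ K ↔
      (∀ i : Fin 5, i ≠ 4 → ((φ X) i 4 = 0 ∧ (φ X) 4 i = 0)))
    (hH : ∀ X : g, X ∈ H ↔ ∃ (Y : g) (t : ℝ), X = Y + t • Zc ∧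
      (∀ i : Fin 5, (φ Y) i 4 = 0 ∧ (φ Y) 4 i = 0) ∧
      ((φ Y).submatrix (Fin.castSucc) (Fin.castSucc) * J₀
        = J₀ * ((φ Y).submatrix (Fin.castSucc) (Fin.castSucc)).map (starRingEnd ℂ)))
    {E2 E4 : Type*}
    [NormedAddCommGroup E2] [InnerProductSpace ℝ E2] [FiniteDimensional ℝ E2]
    [NormedAddCommGroup E4] [InnerProductSpace ℝ E4] [FiniteDimensional ℝ E4]
    (M : ExtModel g E2 E4)
    (F : E2 →ₗ[ℝ] E2)
    (hF : ∀ X Z : g, X ∈ Kᗮ → Z ∈ Kᗮ → ∀ Y W : g, Y ∈ Hᗮ ⊓ K → W ∈ Hᗮ ⊓ K →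
      ⟪F (M.wedge2 X Y), M.wedge2 Z W⟫_ℝ = ⟪br X Y, br Z W⟫_ℝ) :
    ∃ τ ∈ Submodule.span ℝ
        {ω : E4 | ∃ X Y Z W : g, X ∈ Kᗮ ∧ Y ∈ Kᗮ ∧ Z ∈ Hᗮ ⊓ K ∧ W ∈ Hᗮ ⊓ K ∧
          ω = M.wedge4 X Y Z W},
      ∀ σ ∈ Submodule.span ℝ
          {σ : E2 | ∃ X Y : g, X ∈ Kᗮ ∧ Y ∈ Hᗮ ⊓ K ∧ σ = M.wedge2 X Y},
        σ ≠ 0 → 0 < ⟪(F + M.toOp τ) σ, σ⟫_ℝ := by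
  have hskew : ∀ X, (φ X)ᴴ = -φ X := fun X => ((hφ_range _).1 ⟨X, rfl⟩).1
  have htr : ∀ X, (φ X).trace = 0 := fun X => ((hφ_range _).1 ⟨X, rfl⟩).2
  have hm : ∀ X ∈ Kᗮ, (∀ i j : Fin 5, i ≠ 4 → j ≠ 4 → φ X i j = 0) ∧ φ X 4 4 = 0 := by
    intro X hX
    obtain ⟨Y, hY⟩ := (hφ_range (blockDiagPart (φ X))).2 ⟨by
      ext i j
      have := apply_eq_neg_star_of_conjTranspose_eq_neg (hskew X) i j
      change star (blockDiagPart (φ X) j i) = -blockDiagPart (φ X) i j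
      simp only [blockDiagPart, of_apply]
      by_cases h : i = 4 ↔ j = 4
      · rw [if_pos h, if_pos h.symm, this, star_neg, star_star]
      · rw [if_neg h, if_neg fun h' => h h'.symm, star_zero, neg_zero], by
      rw [← htr X]
      simp [Matrix.trace, blockDiagPart]⟩
    have hYK : Y ∈ K := (hK Y).2 fun i hi => by rw [hY]; simp [blockDiagPart, hi]
    have h0 := Submodule.inner_right_of_mem_orthogonal hYK hX
    rw [hQ, hY, neg_eq_zero] at h0
    have hz := blockDiagPart_eq_zero (hskew X) h0
    refine ⟨fun i j hi hj => ?_, ?_⟩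
    · simpa [blockDiagPart, hi, hj] using congrFun (congrFun hz i) j
    · simpa [blockDiagPart] using congrFun (congrFun hz 4) 4
  have hp : ∀ Y ∈ Hᗮ ⊓ K, (∀ i : Fin 5, φ Y i 4 = 0 ∧ φ Y 4 i = 0) ∧
      φ Y * φ Y = ((-⟪Y, Y⟫_ℝ / 4 : ℝ) : ℂ) • diagonal ![1, 1, 1, 1, 0] := by
    rintro Y ⟨hYH, hYK⟩
    have h4 := (hK Y).1 hYK
    have h44 : φ Y 4 4 = 0 := by
      have hZH : Zc ∈ H := (hH Zc).2 ⟨0, 1, by simp, by simp, by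
        simp [show (Matrix.submatrix (0 : Matrix (Fin 5) (Fin 5) ℂ) Fin.castSucc Fin.castSucc) = 0
          from rfl]⟩
      have h0 := Submodule.inner_right_of_mem_orthogonal hZH hYH
      have h1 := htr Y
      have h2 := apply_eq_neg_star_of_conjTranspose_eq_neg (hskew Y) 4 4
      rw [hQ, hZc] at h0
      simp only [Matrix.trace, diag_apply, diagonal_mul, Fin.sum_univ_five] at h0 h1
      have h1' := congrArg Complex.im h1
      have h2' := congrArg Complex.re h2
      simp at h0 h1' h2'
      apply Complex.ext <;> simp <;> linarith
    have hA : ∀ i : Fin 5, φ Y i 4 = 0 ∧ φ Y 4 i = 0 := fun i => by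
      by_cases hi : i = 4
      · subst hi; exact ⟨h44, h44⟩
      · exact h4 i hi
    refine ⟨hA, ?_⟩
    obtain ⟨a, b, c, d, e, f⟩ := apply_eq_of_orthogonal_quaternionic hJ₀ hA (hskew Y)
      fun N hN hNtr hN4 hNJ => by
        obtain ⟨X, rfl⟩ := (hφ_range N).2 ⟨hN, hNtr⟩
        have h0 := Submodule.inner_right_of_mem_orthogonal
          ((hH X).2 ⟨X, 0, by simp, hN4, hNJ⟩) hYH
        rwa [hQ, neg_eq_zero] at h0
    rw [hQ, neg_neg]
    exact mul_self_of_anticommute_quaternionic hA (hskew Y) (htr Y) a b c d e f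
  have hmp : ∀ x ∈ Kᗮ, ∀ y ∈ Hᗮ ⊓ K, ⟪x, y⟫_ℝ = 0 := fun x hx y hy =>
    Submodule.inner_left_of_mem_orthogonal hy.2 hx
  have br_swap : ∀ X Y, br X Y = -br Y X := fun X Y => hφ_inj (by simp [hφ_br])
  have jacobi : ∀ Y W Z, br (br Y W) Z = br Y (br W Z) - br W (br Y Z) := fun Y W Z =>
    hφ_inj (by simp only [hφ_br, map_sub]; noncomm_ring)
  have ad_skew : ∀ U X Z, ⟪X, br U Z⟫_ℝ = -⟪br U X, Z⟫_ℝ := by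
    intro U X Z
    rw [hQ, hQ, hφ_br, hφ_br, ← Complex.neg_re, ← Complex.neg_re, ← Complex.neg_re,
      mul_sub, sub_mul, trace_sub, trace_sub, ← mul_assoc, ← mul_assoc,
      trace_mul_cycle (φ X) (φ Z) (φ U)]
    congr 1
    ring
  have ad_sq : ∀ Y ∈ Hᗮ ⊓ K, ∀ Z ∈ Kᗮ, br Y (br Y Z) = (-⟪Y, Y⟫_ℝ / 4) • Z := by
    intro Y hY Z hZ
    apply hφ_inj
    rw [hφ_br, hφ_br, commutator_commutator_of_block (hp Y hY).1 (hp Y hY).2 (hm Z hZ).1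
      (hm Z hZ).2, map_smul]
    ext i j
    simp
  have clifford : ∀ Y ∈ Hᗮ ⊓ K, ∀ W ∈ Hᗮ ⊓ K, ∀ Z ∈ Kᗮ,
      br Y (br W Z) + br W (br Y Z) = (-⟪Y, W⟫_ℝ / 2) • Z := by
    intro Y hY W hW Z hZ
    have h := ad_sq (Y + W) (add_mem hY hW) Z hZ
    simp only [map_add, LinearMap.add_apply, ad_sq Y hY Z hZ, ad_sq W hW Z hZ,
      real_inner_add_add_self] at h
    linear_combination (norm := module) h
  obtain ⟨τ, hτ, hτ'⟩ := M.exists_mem_span_wedge4 hmp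
    (LinearMap.mk₂ ℝ (fun X Z => LinearMap.mk₂ ℝ (fun Y W => ⟪X, br (br Y W) Z⟫_ℝ / 2)
      (by intros; simp [inner_add_right]; ring) (by intros; simp [inner_smul_right]; ring)
      (by intros; simp [inner_add_right]; ring) (by intros; simp [inner_smul_right]; ring))
      (by intros; ext; simp [inner_add_left]; ring) (by intros; ext; simp [inner_smul_left]; ring)
      (by intros; ext; simp [inner_add_right]; ring)
      (by intros; ext; simp [inner_smul_right]; ring))
    (fun X Z Y W => by
      simp only [LinearMap.mk₂_apply]
      rw [ad_skew, real_inner_comm]; ring)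
    (fun X Z Y W => by
      simp only [LinearMap.mk₂_apply]
      rw [br_swap Y W]; simp; ring)
  simp only [LinearMap.mk₂_apply] at hτ'
  refine ⟨τ, hτ, fun σ hσ hσ0 => ?_⟩
  rw [M.inner_eq_of_mem_span_wedge2 (F + M.toOp τ) ((1 / 4 : ℝ) • LinearMap.id) ?_ hσ hσ]
  · have := real_inner_self_pos.2 hσ0
    simpa [real_inner_smul_left] using this
  · intro X hX Z hZ Y hY W hW
    rw [LinearMap.add_apply, inner_add_left, hF X Z hX hZ Y W hY hW, M.toOp_spec,
      hτ' X hX Z hZ Y hY W hW, LinearMap.smul_apply, LinearMap.id_apply, real_inner_smul_left,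
      M.inner_wedge2, hmp X hX W hW, zero_mul, sub_zero, jacobi, br_swap X Y, br_swap Z W,
      inner_neg_neg, inner_sub_right]
    have h1 := ad_skew Y X (br W Z)
    have h2 := congrArg (fun v => ⟪X, v⟫_ℝ) (clifford Y hY W hW Z hZ)
    simp only [inner_add_right, real_inner_smul_right] at h2
    linarith
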